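/- arXiv:1006.1021 — 8 statements merged into one kernel-verified Lean document; each statement's English description precedes it below -/
import Mathlib

section
/- Let 𝒜 be a unital C*-algebra, H a complex Hilbert space, and Φ : 𝒜 → B(H) a unital n-positive linear map for some integer n ≥ 3. Then for all A, B ∈ 𝒜, ‖Φ(AB) − Φ(A)Φ(B)‖ ≤ Δ(A,‖·‖) · Δ(B,‖·‖). -/
open scoped Matrix
/-- A map `Φ` between star rings is `n`-positive if the induced entrywise map on
`n × n` matrices sends positive elements (i.e. those of the form `Cᴴ * C`) of the matrix
algebra over the domain to positive elements of the matrix algebra over the codomain. -/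
def IsNPositiveMap {𝒜 ℬ : Type*} [Ring 𝒜] [StarRing 𝒜] [Ring ℬ] [StarRing ℬ]
    (Φ : 𝒜 → ℬ) (n : ℕ) : Prop :=
  ∀ M : Matrix (Fin n) (Fin n) 𝒜,
    (∃ C : Matrix (Fin n) (Fin n) 𝒜, M = Cᴴ * C) →
      ∃ D : Matrix (Fin n) (Fin n) ℬ, M.map Φ = Dᴴ * D

open scoped InnerProductSpace

section

variable {𝒜 H : Type*} [NormedRing 𝒜] [StarRing 𝒜] [NormedAddCommGroup H]
  [InnerProductSpace ℂ H] [CompleteSpace H]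

/-- A Kolmogorov-type factorization: an `n`-positive map sends the Gram matrix of any `n` elements
to the Gram matrix of `n` operators. -/
theorem IsNPositiveMap.exists_gram {Φ : 𝒜 → (H →L[ℂ] H)} {n : ℕ} (hn : 0 < n)
    (hΦ : IsNPositiveMap Φ n) (r : Fin n → 𝒜) :
    ∃ V : Fin n → (H →L[ℂ] PiLp 2 (fun _ : Fin n => H)),
      ∀ i j, Φ (star (r i) * r j) = (V i).adjoint ∘L V j := by
  obtain ⟨D, hD⟩ := hΦ _ ⟨Matrix.of fun i j => if i = ⟨0, hn⟩ then r j else 0, rfl⟩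
  refine ⟨fun j => (PiLp.continuousLinearEquiv 2 ℂ (fun _ : Fin n => H)).symm.toContinuousLinearMap
    ∘L ContinuousLinearMap.pi fun k => D k j, fun i j => ?_⟩
  have h : Φ (star (r i) * r j) = ∑ k, star (D k i) * D k j := by
    simpa [Matrix.mul_apply, apply_ite] using congrFun (congrFun hD i) j
  rw [h]
  ext x
  refine ext_inner_left ℂ fun y => ?_
  simp [ContinuousLinearMap.adjoint_inner_right, PiLp.inner_apply, inner_sum,
    ContinuousLinearMap.star_eq_adjoint]

variable [CStarRing 𝒜] [NormedAlgebra ℂ 𝒜] [StarModule ℂ 𝒜] [CompleteSpace 𝒜]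

theorem exists_star_mul_self_add_eq_norm_sq (b : 𝒜) :
    ∃ c : 𝒜, star c * c + star b * b = ((‖b‖ ^ 2 : ℝ) : ℂ) • (1 : 𝒜) := by
  let : CStarAlgebra 𝒜 := {}
  let := CStarAlgebra.spectralOrder 𝒜
  let := CStarAlgebra.spectralOrderedRing 𝒜
  have h : 0 ≤ algebraMap ℝ 𝒜 (‖b‖ ^ 2) - star b * b :=
    sub_nonneg.2 CStarAlgebra.star_mul_le_algebraMap_norm_sq
  obtain ⟨c, hc⟩ := CStarAlgebra.nonneg_iff_eq_star_mul_self.1 h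
  refine ⟨c, ?_⟩
  rw [← hc, sub_add_cancel, Algebra.algebraMap_eq_smul_one]
  exact (Complex.coe_smul _ _).symm

theorem IsNPositiveMap.norm_le_of_adjoint_comp_self_eq {E : Type*} [NormedAddCommGroup E]
    [InnerProductSpace ℂ E] [CompleteSpace E] {Φ : 𝒜 →ₗ[ℂ] (H →L[ℂ] H)} (hΦ1 : Φ 1 = 1) {n : ℕ}
    (hn : 0 < n) (hΦ : IsNPositiveMap (⇑Φ) n) {b : 𝒜} {V : H →L[ℂ] E}
    (hV : Φ (star b * b) = V.adjoint ∘L V) : ‖V‖ ≤ ‖b‖ := by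
  obtain ⟨c, hc⟩ := exists_star_mul_self_add_eq_norm_sq b
  obtain ⟨W, hW⟩ := hΦ.exists_gram hn fun _ => c
  refine V.opNorm_le_bound (norm_nonneg _) fun x => ?_
  have h := congrArg (fun T : H →L[ℂ] H => ⟪x, T x⟫_ℂ) (congrArg Φ hc)
  simp only [map_add, map_smul, hΦ1, hW ⟨0, hn⟩ ⟨0, hn⟩, hV, add_apply,
    ContinuousLinearMap.comp_apply, inner_add_right, ContinuousLinearMap.adjoint_inner_right,
    inner_self_eq_norm_sq_to_K, smul_apply, one_apply_eq_self,
    inner_smul_right, Complex.coe_algebraMap] at h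
  have h' : ‖W ⟨0, hn⟩ x‖ ^ 2 + ‖V x‖ ^ 2 = ‖b‖ ^ 2 * ‖x‖ ^ 2 := by
    exact_mod_cast h
  refine le_of_sq_le_sq ?_ (by positivity)
  nlinarith [sq_nonneg ‖W ⟨0, hn⟩ x‖]

end

theorem norm_adjoint_comp_sub_le {H E : Type*} [NormedAddCommGroup H] [InnerProductSpace ℂ H]
    [CompleteSpace H] [NormedAddCommGroup E] [InnerProductSpace ℂ E] [CompleteSpace E]
    (U V W : H →L[ℂ] E) (hW : W.adjoint ∘L W = 1) :
    ‖U.adjoint ∘L V - (U.adjoint ∘L W) ∘L (W.adjoint ∘L V)‖ ≤ ‖U‖ * ‖V‖ := by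
  have hW' : ∀ x, W.adjoint (W x) = x := fun x => DFunLike.congr_fun hW x
  have hP : IsStarProjection (W ∘L W.adjoint) := by
    refine ⟨?_, ?_⟩
    · ext x
      simp [hW']
    · simp [IsSelfAdjoint, ContinuousLinearMap.star_eq_adjoint, ContinuousLinearMap.adjoint_comp]
  have h : U.adjoint ∘L V - (U.adjoint ∘L W) ∘L (W.adjoint ∘L V)
      = U.adjoint ∘L ((1 - W ∘L W.adjoint) ∘L V) := by
    ext x
    simp
  rw [h]
  calc _ ≤ ‖U.adjoint‖ * (‖1 - W ∘L W.adjoint‖ * ‖V‖) :=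
        (ContinuousLinearMap.opNorm_comp_le _ _).trans
          (by gcongr; exact ContinuousLinearMap.opNorm_comp_le _ _)
    _ ≤ ‖U‖ * (1 * ‖V‖) := by
        rw [LinearIsometryEquiv.norm_map]
        gcongr
        exact hP.one_sub.norm_le
    _ = ‖U‖ * ‖V‖ := by rw [one_mul]

theorem IsNPositiveMap.norm_map_mul_sub_le {𝒜 : Type*} [NormedRing 𝒜] [StarRing 𝒜] [CStarRing 𝒜]
    [NormedAlgebra ℂ 𝒜] [StarModule ℂ 𝒜] [CompleteSpace 𝒜]
    {H : Type*} [NormedAddCommGroup H] [InnerProductSpace ℂ H] [CompleteSpace H]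
    {Φ : 𝒜 →ₗ[ℂ] (H →L[ℂ] H)} (hΦ1 : Φ 1 = 1) {n : ℕ} (hn : 3 ≤ n)
    (hΦ : IsNPositiveMap (⇑Φ) n) (A B : 𝒜) : ‖Φ (A * B) - Φ A * Φ B‖ ≤ ‖A‖ * ‖B‖ := by
  have hn0 : 0 < n := by omega
  obtain ⟨V, hV⟩ := hΦ.exists_gram hn0
    fun i => if i.1 = 0 then star A else if i.1 = 1 then B else 1
  have hU := hV ⟨0, hn0⟩ ⟨0, hn0⟩
  have hB := hV ⟨1, by omega⟩ ⟨1, by omega⟩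
  have hW := hV ⟨2, hn⟩ ⟨2, hn⟩
  have hUB := hV ⟨0, hn0⟩ ⟨1, by omega⟩
  have hUW := hV ⟨0, hn0⟩ ⟨2, hn⟩
  have hWB := hV ⟨2, hn⟩ ⟨1, by omega⟩
  simp only [↓reduceIte, one_ne_zero, OfNat.ofNat_ne_zero, OfNat.ofNat_ne_one, star_one, one_mul,
    mul_one, star_star, hΦ1] at hB hW hUB hUW hWB
  rw [hUB, hUW, hWB]
  refine (norm_adjoint_comp_sub_le _ _ _ hW.symm).trans ?_
  rw [← norm_star A]
  gcongr
  · exact hΦ.norm_le_of_adjoint_comp_self_eq hΦ1 hn0 hU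
  · exact hΦ.norm_le_of_adjoint_comp_self_eq hΦ1 hn0 hB

/-- A Grüss inequality for unital `n`-positive linear maps (`n ≥ 3`) from a unital
`C*`-algebra into `B(H)`:
`‖Φ(AB) − Φ(A)Φ(B)‖ ≤ Δ(A,‖·‖) Δ(B,‖·‖)`, where `Δ(C,‖·‖) = inf_{λ ∈ ℂ} ‖C − λ·1‖`. -/
theorem gruss_nPositive
    {𝒜 : Type*} [NormedRing 𝒜] [StarRing 𝒜] [CStarRing 𝒜] [NormedAlgebra ℂ 𝒜]
    [StarModule ℂ 𝒜] [CompleteSpace 𝒜]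
    {H : Type*} [NormedAddCommGroup H] [InnerProductSpace ℂ H] [CompleteSpace H]
    (Φ : 𝒜 →ₗ[ℂ] (H →L[ℂ] H)) (hΦ1 : Φ 1 = 1)
    (n : ℕ) (hn : 3 ≤ n) (hΦ : IsNPositiveMap (⇑Φ) n)
    (A B : 𝒜) :
    ‖Φ (A * B) - Φ A * Φ B‖ ≤
      (⨅ z : ℂ, ‖A - z • (1 : 𝒜)‖) * (⨅ z : ℂ, ‖B - z • (1 : 𝒜)‖) := by
  rw [Real.iInf_mul_of_nonneg (Real.iInf_nonneg fun _ => norm_nonneg _)]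
  refine le_ciInf fun z => ?_
  rw [Real.mul_iInf_of_nonneg (norm_nonneg _)]
  refine le_ciInf fun w => ?_
  have h : Φ (A * B) - Φ A * Φ B =
      Φ ((A - z • 1) * (B - w • 1)) - Φ (A - z • 1) * Φ (B - w • 1) := by
    simp only [sub_mul, mul_sub, map_sub, map_smul, hΦ1, smul_mul_assoc, mul_smul_comm, one_mul,
      mul_one]
    abel
  rw [h]
  exact hΦ.norm_map_mul_sub_le hΦ1 hn _ _
end

section
/- Let 𝒜 be a unital C*-algebra, H a complex Hilbert space, and Φ : 𝒜 → B(H) a unital map (not necessarily linear) satisfying Φ(A*) = Φ(A)* for all A ∈ 𝒜, which is n-positive for some integer n ≥ 3. Then for all A, B ∈ 𝒜, ‖Φ(AB) − Φ(A)Φ(B)‖² ≤ ‖Φ(AA*) − Φ(A)Φ(A)*‖ · ‖Φ(B*B) − Φ(B)*Φ(B)‖. -/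
open scoped Matrix

/-- The quadratic form of an operator matrix of the form `Dᴴ * D` is nonnegative. -/
lemma re_sum_inner_conjTranspose_mul_self_nonneg
    {H : Type*} [NormedAddCommGroup H] [InnerProductSpace ℂ H] [CompleteSpace H]
    {m k : Type*} [Fintype m] [Fintype k] (D : Matrix m k (H →L[ℂ] H)) (v : k → H) :
    0 ≤ (∑ i, ∑ j, inner ℂ (v i) ((Dᴴ * D) i j (v j))).re := by
  have h : ∑ i, ∑ j, inner ℂ (v i) ((Dᴴ * D) i j (v j)) =
      ∑ l, inner ℂ (∑ i, D l i (v i)) (∑ j, D l j (v j)) := by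
    have hent (i j : k) : inner ℂ (v i) ((Dᴴ * D) i j (v j)) =
        ∑ l, inner ℂ (D l i (v i)) (D l j (v j)) := by
      rw [Matrix.mul_apply, sum_apply, inner_sum]
      exact Finset.sum_congr rfl fun l _ =>
        ContinuousLinearMap.adjoint_inner_right (D l i) (v i) (D l j (v j))
    simp only [hent, sum_inner, inner_sum]
    calc ∑ i, ∑ j, ∑ l, inner ℂ (D l i (v i)) (D l j (v j))
        = ∑ i, ∑ l, ∑ j, inner ℂ (D l i (v i)) (D l j (v j)) :=
          Finset.sum_congr rfl fun i _ => Finset.sum_comm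
      _ = ∑ l, ∑ i, ∑ j, inner ℂ (D l i (v i)) (D l j (v j)) := Finset.sum_comm
      _ = ∑ l, ∑ j, ∑ i, inner ℂ (D l i (v i)) (D l j (v j)) :=
          Finset.sum_congr rfl fun l _ => Finset.sum_comm
  rw [h, Complex.re_sum]
  exact Finset.sum_nonneg fun l _ => inner_self_nonneg (𝕜 := ℂ)

/-- If the Hermitian form with blocks `P`, `T`, `T*`, `Q` is nonnegative, then
`‖T‖² ≤ ‖P‖ ‖Q‖`. -/
lemma sq_norm_le_of_block_nonneg
    {H : Type*} [NormedAddCommGroup H] [InnerProductSpace ℂ H] (P T Q : H →L[ℂ] H)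
    (h : ∀ x y : H, 0 ≤ (inner ℂ x (P x)).re + 2 * (inner ℂ x (T y)).re + (inner ℂ y (Q y)).re) :
    ‖T‖ ^ 2 ≤ ‖P‖ * ‖Q‖ := by
  have hre (S : H →L[ℂ] H) (x : H) : (inner ℂ x (S x)).re ≤ ‖S‖ * ‖x‖ ^ 2 := by
    calc (inner ℂ x (S x)).re ≤ ‖x‖ * ‖S x‖ := re_inner_le_norm (𝕜 := ℂ) x (S x)
      _ ≤ ‖x‖ * (‖S‖ * ‖x‖) := by gcongr; exact S.le_opNorm x
      _ = ‖S‖ * ‖x‖ ^ 2 := by ring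
  have hT (y : H) : ‖T y‖ ≤ √(‖P‖ * ‖Q‖) * ‖y‖ := by
    have hquad (s : ℝ) :
        0 ≤ (‖P‖ * ‖T y‖ ^ 2) * (s * s) + (-2 * ‖T y‖ ^ 2) * s + ‖Q‖ * ‖y‖ ^ 2 := by
      have h1 := h ((-s : ℂ) • T y) y
      have h2 := hre P ((-s : ℂ) • T y)
      have h3 := hre Q y
      have h4 : (inner ℂ ((-s : ℂ) • T y) (T y)).re = -s * ‖T y‖ ^ 2 := by
        rw [inner_smul_left, inner_self_eq_norm_sq_to_K]
        simp [← Complex.ofReal_pow]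
      have h5 : ‖(-s : ℂ) • T y‖ ^ 2 = s * s * ‖T y‖ ^ 2 := by
        rw [norm_smul, mul_pow, norm_neg, Complex.norm_real, Real.norm_eq_abs, sq_abs, sq s]
      rw [h5] at h2
      linarith
    have hd := discrim_le_zero hquad
    rw [discrim] at hd
    rcases (norm_nonneg (T y)).eq_or_lt with h0 | h0
    · rw [← h0]; positivity
    · refine le_of_sq_le_sq ?_ (by positivity)
      rw [mul_pow, Real.sq_sqrt (by positivity)]
      refine le_of_mul_le_mul_left ?_ (pow_pos h0 2)
      linarith
  calc ‖T‖ ^ 2 ≤ √(‖P‖ * ‖Q‖) ^ 2 := by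
        gcongr; exact T.opNorm_le_bound (Real.sqrt_nonneg _) hT
    _ = ‖P‖ * ‖Q‖ := Real.sq_sqrt (by positivity)

/-- An `n`-positive map sends Gram matrices of families indexed by a subset of `Fin n` to
operator matrices with nonnegative quadratic form. -/
lemma IsNPositiveMap.re_sum_inner_gram_nonneg
    {𝒜 : Type*} [Ring 𝒜] [StarRing 𝒜]
    {H : Type*} [NormedAddCommGroup H] [InnerProductSpace ℂ H] [CompleteSpace H]
    {Φ : 𝒜 → (H →L[ℂ] H)} {m n : ℕ} (hmn : m ≤ n) (hm : 0 < m) (hΦ : IsNPositiveMap Φ n)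
    (r : Fin m → 𝒜) (v : Fin m → H) :
    0 ≤ (∑ i, ∑ j, inner ℂ (v i) (Φ (star (r i) * r j) (v j))).re := by
  let e : Fin m → Fin n := Fin.castLE hmn
  let r' : Fin n → 𝒜 := Function.extend e r 0
  have hr (i : Fin m) : r' (e i) = r i := (Fin.castLE_injective hmn).extend_apply r 0 i
  let i₀ : Fin n := ⟨0, hm.trans_le hmn⟩
  let C : Matrix (Fin n) (Fin n) 𝒜 := Matrix.of fun i j => if i = i₀ then r' j else 0
  obtain ⟨D, hD⟩ := hΦ (Cᴴ * C) ⟨C, rfl⟩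
  have hC (i j : Fin n) : (Cᴴ * C) i j = star (r' i) * r' j := by
    simp [Matrix.mul_apply, C, apply_ite star]
  have hent (i j : Fin m) :
      ((D.submatrix id e)ᴴ * D.submatrix id e) i j = Φ (star (r i) * r j) := by
    rw [← hr i, ← hr j, ← hC]
    exact (congrFun (congrFun hD (e i)) (e j)).symm
  simpa only [hent] using re_sum_inner_conjTranspose_mul_self_nonneg (D.submatrix id e) v

/-- For a unital star-preserving (not necessarily linear) `n`-positive map `Φ` (`n ≥ 3`)
from a unital `C*`-algebra into `B(H)` one has the Cauchy–Schwarz type inequality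
`‖Φ(AB) − Φ(A)Φ(B)‖² ≤ ‖Φ(AA*) − Φ(A)Φ(A)*‖ ‖Φ(B*B) − Φ(B)*Φ(B)‖`. -/
theorem cauchySchwarz_nPositive
    {𝒜 : Type*} [NormedRing 𝒜] [StarRing 𝒜] [CStarRing 𝒜] [NormedAlgebra ℂ 𝒜]
    [StarModule ℂ 𝒜] [CompleteSpace 𝒜]
    {H : Type*} [NormedAddCommGroup H] [InnerProductSpace ℂ H] [CompleteSpace H]
    (Φ : 𝒜 → (H →L[ℂ] H)) (hΦ1 : Φ 1 = 1)
    (hΦstar : ∀ A : 𝒜, Φ (star A) = star (Φ A))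
    (n : ℕ) (hn : 3 ≤ n) (hΦ : IsNPositiveMap Φ n)
    (A B : 𝒜) :
    ‖Φ (A * B) - Φ A * Φ B‖ ^ 2 ≤
      ‖Φ (A * star A) - Φ A * star (Φ A)‖ * ‖Φ (star B * B) - star (Φ B) * Φ B‖ := by
  refine sq_norm_le_of_block_nonneg _ _ _ fun x y => ?_
  have h := hΦ.re_sum_inner_gram_nonneg hn (by norm_num) ![star A, B, 1]
    ![x, y, -(star (Φ A) x + Φ B y)]
  have hBA : Φ (star B * star A) = star (Φ (A * B)) := by rw [← hΦstar, star_mul]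
  have hA (w : H) : inner ℂ x (Φ A w) = inner ℂ (star (Φ A) x) w :=
    (ContinuousLinearMap.adjoint_inner_left (Φ A) w x).symm
  have hB (w : H) : inner ℂ y (star (Φ B) w) = inner ℂ (Φ B y) w :=
    ContinuousLinearMap.adjoint_inner_right (Φ B) y w
  have hAB : inner ℂ y (star (Φ (A * B)) x) = inner ℂ (Φ (A * B) y) x :=
    ContinuousLinearMap.adjoint_inner_right (Φ (A * B)) y x
  have hsymm₁ := inner_re_symm (𝕜 := ℂ) (Φ (A * B) y) x
  have hsymm₂ := inner_re_symm (𝕜 := ℂ) (Φ B y) (star (Φ A) x)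
  simp only [RCLike.re_to_complex] at hsymm₁ hsymm₂
  simp only [Fin.sum_univ_three, Matrix.cons_val, star_one, one_mul, mul_one, star_star, hΦ1,
    hΦstar, hBA, hA, hB, hAB, one_apply_eq_self, inner_neg_left, inner_neg_right,
    inner_add_left, inner_add_right, Complex.add_re, Complex.neg_re] at h
  simp only [sub_apply, mul_apply_eq_comp, inner_sub_right, hA, hB, Complex.sub_re]
  linarith
end

section
/- Let 𝒜 be a unital C*-algebra, H a complex Hilbert space, and Φ : 𝒜 → B(H) a unital map satisfying Φ(A*) = Φ(A)* for all A ∈ 𝒜, which is n-positive for some integer n ≥ 3. Then for all A, B ∈ 𝒜, the 2×2 operator matrix [[Φ(A*A) − Φ(A)*Φ(A), Φ(A*B) − Φ(A)*Φ(B)], [Φ(B*A) − Φ(B)*Φ(A), Φ(B*B) − Φ(B)*Φ(B)]] is a positive element of the C*-algebra M₂(B(H)) of 2×2 matrices over B(H). (This is the operator covariance–variance inequality.) -/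
open scoped Matrix

/-- An `n`-positive map sends the Gram matrix of any `n` elements to a Gram matrix. -/
theorem IsNPositiveMap.exists_map_star_mul_eq_sum {𝒜 ℬ : Type*} [Ring 𝒜] [StarRing 𝒜]
    [Ring ℬ] [StarRing ℬ] {Φ : 𝒜 → ℬ} {n : ℕ} [NeZero n] (hΦ : IsNPositiveMap Φ n)
    (v : Fin n → 𝒜) :
    ∃ D : Matrix (Fin n) (Fin n) ℬ,
      ∀ i j, Φ (star (v i) * v j) = ∑ k, star (D k i) * D k j := by
  obtain ⟨D, hD⟩ := hΦ _ ⟨Matrix.of fun i j ↦ if i = 0 then v j else 0, rfl⟩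
  refine ⟨D, fun i j ↦ ?_⟩
  have h := congrFun (congrFun hD i) j
  simpa [Matrix.mul_apply, Matrix.conjTranspose_apply, apply_ite star] using h

/-- Subtracting from each column of `D` its component along a normalized column `c` replaces
the Gram matrix by its Schur complement. -/
theorem sum_star_sub_mul_sub {ℬ κ : Type*} [Ring ℬ] [StarRing ℬ] [Fintype κ]
    (c x y : κ → ℬ) (p q : ℬ) (hc : ∑ k, star (c k) * c k = 1)
    (hp : ∑ k, star (c k) * x k = p) (hq : ∑ k, star (c k) * y k = q) :
    ∑ k, star (x k - c k * p) * (y k - c k * q) = ∑ k, star (x k) * y k - star p * q := by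
  have hp' : ∑ k, star (x k) * c k = star p := by simp [← hp]
  calc
    _ = ∑ k, star (x k) * y k - (∑ k, star (x k) * c k) * q
          - star p * (∑ k, star (c k) * y k) + star p * (∑ k, star (c k) * c k) * q := by
      simp only [Finset.sum_mul, Finset.mul_sum, ← Finset.sum_sub_distrib,
        ← Finset.sum_add_distrib]
      refine Finset.sum_congr rfl fun k _ ↦ ?_
      simp only [star_sub, star_mul]
      noncomm_ring
    _ = _ := by
      rw [hp', hq, hc]
      noncomm_ring

/-- In a C⋆-algebra a finite sum of elements `star x * x` is again of this form. -/
theorem CStarAlgebra.exists_sum_star_mul_self_eq {X κ : Type*} [CStarAlgebra X] [Fintype κ]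
    (f : κ → X) : ∃ d, ∑ k, star (f k) * f k = star d * d := by
  let _ : PartialOrder X := CStarAlgebra.spectralOrder X
  have _ : StarOrderedRing X := CStarAlgebra.spectralOrderedRing X
  exact CStarAlgebra.nonneg_iff_eq_star_mul_self.mp
    (Finset.sum_nonneg fun k _ ↦ star_mul_self_nonneg (f k))

/-- Over a C⋆-algebra, a Gram matrix of finitely many columns of arbitrary length is
also the Gram matrix of a square matrix. -/
theorem exists_conjTranspose_mul_self_eq_rectangular {ℬ κ m : Type*} [CStarAlgebra ℬ]
    [PartialOrder ℬ] [StarOrderedRing ℬ] [Fintype κ] [Fintype m] [DecidableEq m] [Nonempty m]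
    (E : Matrix κ m ℬ) : ∃ D : Matrix m m ℬ, Eᴴ * E = Dᴴ * D := by
  obtain ⟨r⟩ := ‹Nonempty m›
  let F : κ → CStarMatrix m m ℬ :=
    fun k ↦ CStarMatrix.ofMatrix (Matrix.of fun i j ↦ if i = r then E k j else 0)
  obtain ⟨D, hD⟩ := CStarAlgebra.exists_sum_star_mul_self_eq F
  refine ⟨CStarMatrix.ofMatrix.symm D, ?_⟩
  have hE : Eᴴ * E = CStarMatrix.ofMatrix.symm (∑ k, star (F k) * F k) := by
    ext1 i j
    have hk (k : κ) : (star (F k) * F k) i j = star (E k i) * E k j := by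
      simp [F, CStarMatrix.mul_apply, CStarMatrix.star_apply, apply_ite star]
    change _ = (∑ k, star (F k) * F k) i j
    have hs : (∑ k, star (F k) * F k) i j = ∑ k, (star (F k) * F k) i j :=
      Matrix.sum_apply i j Finset.univ fun k ↦ (star (F k) * F k : CStarMatrix m m ℬ)
    rw [hs]
    simp [hk, Matrix.mul_apply, Matrix.conjTranspose_apply]
  rw [hE, hD]
  rfl

/-- The operator covariance–variance inequality: for a unital star-preserving
`n`-positive map `Φ` (`n ≥ 3`) from a unital `C*`-algebra into `B(H)`, the `2 × 2`
operator matrix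
`[[Φ(A*A) − Φ(A)*Φ(A), Φ(A*B) − Φ(A)*Φ(B)], [Φ(B*A) − Φ(B)*Φ(A), Φ(B*B) − Φ(B)*Φ(B)]]`
is a positive element of `M₂(B(H))`. -/
theorem covariance_variance_nPositive
    {𝒜 : Type*} [NormedRing 𝒜] [StarRing 𝒜] [CStarRing 𝒜] [NormedAlgebra ℂ 𝒜]
    [StarModule ℂ 𝒜] [CompleteSpace 𝒜]
    {H : Type*} [NormedAddCommGroup H] [InnerProductSpace ℂ H] [CompleteSpace H]
    (Φ : 𝒜 → (H →L[ℂ] H)) (hΦ1 : Φ 1 = 1)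
    (hΦstar : ∀ A : 𝒜, Φ (star A) = star (Φ A))
    (n : ℕ) (hn : 3 ≤ n) (hΦ : IsNPositiveMap Φ n)
    (A B : 𝒜) :
    ∃ D : Matrix (Fin 2) (Fin 2) (H →L[ℂ] H),
      !![Φ (star A * A) - star (Φ A) * Φ A, Φ (star A * B) - star (Φ A) * Φ B;
         Φ (star B * A) - star (Φ B) * Φ A, Φ (star B * B) - star (Φ B) * Φ B] = Dᴴ * D := by
  obtain ⟨n, rfl⟩ := Nat.exists_eq_add_of_le' hn
  let _ : CStarAlgebra (H →L[ℂ] H) := { }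
  let e : Fin 2 → Fin (n + 3) := ![1, 2]
  let a : Fin 2 → 𝒜 := ![A, B]
  let v : Fin (n + 3) → 𝒜 := Fin.cons 1 (Fin.cons A fun _ ↦ B)
  have hv0 : v 0 = 1 := rfl
  have hva (i : Fin 2) : v (e i) = a i := by
    fin_cases i <;> rfl
  obtain ⟨D, hD⟩ := hΦ.exists_map_star_mul_eq_sum v
  have h00 : ∑ k, star (D k 0) * D k 0 = 1 := by rw [← hD, hv0]; simpa using hΦ1
  have h0 (i : Fin 2) : ∑ k, star (D k 0) * D k (e i) = Φ (a i) := by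
    rw [← hD, hv0, hva]; simp
  obtain ⟨G, hG⟩ := exists_conjTranspose_mul_self_eq_rectangular
    (Matrix.of fun (k : Fin (n + 3)) (i : Fin 2) ↦ D k (e i) - D k 0 * Φ (a i))
  refine ⟨G, hG ▸ ?_⟩
  have hS (i j : Fin 2) :
      ∑ k, star (D k (e i) - D k 0 * Φ (a i)) * (D k (e j) - D k 0 * Φ (a j)) =
        Φ (star (a i) * a j) - star (Φ (a i)) * Φ (a j) := by
    rw [sum_star_sub_mul_sub _ (fun k ↦ D k (e i)) (fun k ↦ D k (e j)) _ _ h00 (h0 i) (h0 j),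
      ← hD, hva, hva]
  ext1 i j
  rw [Matrix.mul_apply]
  simp only [Matrix.conjTranspose_apply, Matrix.of_apply, hS]
  fin_cases i <;> fin_cases j <;> rfl
end

section
/- Let 𝒜 be a unital C*-algebra, H a complex Hilbert space, and Φ : 𝒜 → B(H) a unital map satisfying Φ(A*) = Φ(A)* for all A ∈ 𝒜, which is n-positive for some integer n ≥ 3. Then for all A, B ∈ 𝒜, ‖Φ(A*B) − Φ(A)*Φ(B)‖² ≤ ‖Φ(A*A) − Φ(A)*Φ(A)‖ · ‖Φ(B*B) − Φ(B)*Φ(B)‖. -/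
open scoped Matrix

/-- Cauchy–Schwarz for the `B(H)`-valued inner product on finite tuples of operators. -/
theorem norm_sum_star_mul_sq_le {ι H : Type*} [Fintype ι] [NormedAddCommGroup H]
    [InnerProductSpace ℂ H] [CompleteSpace H] (E F : ι → (H →L[ℂ] H)) :
    ‖∑ k, star (E k) * F k‖ ^ 2 ≤ ‖∑ k, star (E k) * E k‖ * ‖∑ k, star (F k) * F k‖ := by
  let tuple := (WithCStarModule.equiv (H →L[ℂ] H) (ι → (H →L[ℂ] H))).symm
  have h := pow_le_pow_left₀ (norm_nonneg _) (CStarModule.norm_inner_le (A := H →L[ℂ] H)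
    (WithCStarModule (H →L[ℂ] H) (ι → (H →L[ℂ] H)))
    (x := tuple fun k ↦ star (F k)) (y := tuple fun k ↦ star (E k))) 2
  rw [mul_pow, WithCStarModule.pi_norm_sq, WithCStarModule.pi_norm_sq,
    WithCStarModule.pi_inner, mul_comm (‖_‖)] at h
  simpa [tuple, WithCStarModule.inner_def] using h

/-- For a unital star-preserving `n`-positive map `Φ` (`n ≥ 3`) from a unital
`C*`-algebra into `B(H)` one has
`‖Φ(A*B) − Φ(A)*Φ(B)‖² ≤ ‖Φ(A*A) − Φ(A)*Φ(A)‖ ‖Φ(B*B) − Φ(B)*Φ(B)‖`. -/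
theorem cauchySchwarz_star_nPositive
    {𝒜 : Type*} [NormedRing 𝒜] [StarRing 𝒜] [CStarRing 𝒜] [NormedAlgebra ℂ 𝒜]
    [StarModule ℂ 𝒜] [CompleteSpace 𝒜]
    {H : Type*} [NormedAddCommGroup H] [InnerProductSpace ℂ H] [CompleteSpace H]
    (Φ : 𝒜 → (H →L[ℂ] H)) (hΦ1 : Φ 1 = 1)
    (hΦstar : ∀ A : 𝒜, Φ (star A) = star (Φ A))
    (n : ℕ) (hn : 3 ≤ n) (hΦ : IsNPositiveMap Φ n)
    (A B : 𝒜) :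
    ‖Φ (star A * B) - star (Φ A) * Φ B‖ ^ 2 ≤
      ‖Φ (star A * A) - star (Φ A) * Φ A‖ * ‖Φ (star B * B) - star (Φ B) * Φ B‖ := by
  let c : Fin n → 𝒜 := fun i ↦ if i.1 = 0 then A else if i.1 = 1 then B else
    if i.1 = 2 then 1 else 0
  let i₀ : Fin n := ⟨0, by omega⟩
  let i₁ : Fin n := ⟨1, by omega⟩
  let i₂ : Fin n := ⟨2, by omega⟩
  have h₀ : c i₀ = A := by simp [c, i₀]
  have h₁ : c i₁ = B := by simp [c, i₁]
  have h₂ : c i₂ = 1 := by simp [c, i₂]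
  obtain ⟨D, hD⟩ := hΦ (Matrix.of fun i j ↦ star (c i) * c j)
    ⟨Matrix.of fun k j ↦ if k = i₀ then c j else 0, by
      ext i j
      simp [Matrix.mul_apply, Matrix.conjTranspose_apply, apply_ite star]⟩
  have key (i j : Fin n) : ∑ k, star (D k i) * D k j = Φ (star (c i) * c j) := by
    have := congrFun (congrFun hD i) j
    simpa [Matrix.mul_apply, Matrix.conjTranspose_apply] using this.symm
  have hsum (i j : Fin n) :
      ∑ k, star (D k i - D k i₂ * Φ (c i)) * (D k j - D k i₂ * Φ (c j)) =
        Φ (star (c i) * c j) - star (Φ (c i)) * Φ (c j) := by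
    have expand (k : Fin n) :
        star (D k i - D k i₂ * Φ (c i)) * (D k j - D k i₂ * Φ (c j)) =
          star (D k i) * D k j - (star (D k i) * D k i₂) * Φ (c j)
            - star (Φ (c i)) * (star (D k i₂) * D k j)
            + star (Φ (c i)) * (star (D k i₂) * D k i₂) * Φ (c j) := by
      rw [star_sub, star_mul]
      noncomm_ring
    simp_rw [expand, Finset.sum_add_distrib, Finset.sum_sub_distrib, ← Finset.sum_mul,
      ← Finset.mul_sum, key, h₂, star_one, one_mul, mul_one, hΦ1, hΦstar]
    noncomm_ring
  have h := norm_sum_star_mul_sq_le (fun k ↦ D k i₀ - D k i₂ * Φ (c i₀))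
    (fun k ↦ D k i₁ - D k i₂ * Φ (c i₁))
  rwa [hsum, hsum, hsum, h₀, h₁] at h
end

section
/- Let 𝒜 be a unital C*-algebra, H a complex Hilbert space, and Φ : 𝒜 → B(H) a unital positive linear map. Then for every normal element A ∈ 𝒜 (i.e., A*A = AA*), ‖Φ(A*A) − Φ(A)*Φ(A)‖ ≤ Δ(A,‖·‖)². -/
open Complex in
/-- A continuous function on a compact space admits finite partitions of unity `∑ w̄ᵢ wᵢ = 1` such
that the function is nearly constant on the support of each `wᵢ`. -/
theorem exists_finset_sum_star_mul_self_eq_one {X E : Type*} [TopologicalSpace X] [CompactSpace X]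
    [PseudoMetricSpace E] (f : C(X, E)) {ε : ℝ} (hε : 0 < ε) :
    ∃ (t : Finset X) (w : X → C(X, ℂ)), ∑ c ∈ t, star (w c) * w c = 1 ∧
      ∀ c x, w c x ≠ 0 → dist (f x) (f c) < ε := by
  obtain ⟨t, -, ht⟩ := isCompact_univ.elim_nhds_subcover
    (fun c : X => {x | dist (f x) (f c) < ε}) (fun c _ =>
      (isOpen_lt (by fun_prop) continuous_const).mem_nhds (by simpa using hε))
  let b : X → X → ℝ := fun c x => max 0 (ε - dist (f x) (f c))
  let s : X → ℝ := fun x => ∑ c ∈ t, b c x ^ 2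
  have hb (c : X) : Continuous (b c) := by fun_prop
  have hs : Continuous s := by fun_prop
  have hspos (x : X) : 0 < s x := by
    obtain ⟨c, hc, hxc⟩ := by simpa using ht (Set.mem_univ x)
    refine Finset.sum_pos' (fun i _ => sq_nonneg _) ⟨c, hc, pow_pos ?_ 2⟩
    exact lt_max_of_lt_right (sub_pos.2 hxc)
  have hsqrt (x : X) : √(s x) ≠ 0 := (Real.sqrt_pos.2 (hspos x)).ne'
  refine ⟨t, fun c => ⟨fun x => ((b c x / √(s x) : ℝ) : ℂ),
    continuous_ofReal.comp ((hb c).div hs.sqrt hsqrt)⟩, ?_, fun c x hx => ?_⟩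
  · ext x
    simp only [ContinuousMap.sum_apply, ContinuousMap.mul_apply, ContinuousMap.star_apply,
      ContinuousMap.coe_mk, ContinuousMap.one_apply, RCLike.star_def, conj_ofReal]
    norm_cast
    calc ∑ c ∈ t, b c x / √(s x) * (b c x / √(s x))
        = ∑ c ∈ t, b c x ^ 2 / s x := Finset.sum_congr rfl fun c _ => by
          rw [div_mul_div_comm, Real.mul_self_sqrt (hspos x).le, sq]
      _ = 1 := by rw [← Finset.sum_div]; exact div_self (hspos x).ne'
  · by_contra! h
    exact hx (by simp [b, max_eq_left (sub_nonpos.2 h)])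

/-- If `f` is within `ε` of `g c` on the support of each `w c`, where `∑ w̄ w = 1`, then `f` is
uniformly within `ε` of `∑ g c • w̄ w`. -/
theorem dist_sum_smul_star_mul_self_le {X ι : Type*} [TopologicalSpace X] [CompactSpace X]
    {t : Finset ι} {w : ι → C(X, ℂ)} (hw : ∑ c ∈ t, star (w c) * w c = 1) (f : C(X, ℂ))
    (g : ι → ℂ) {ε : ℝ} (hε : 0 ≤ ε) (h : ∀ c x, w c x ≠ 0 → dist (f x) (g c) ≤ ε) :
    dist f (∑ c ∈ t, g c • (star (w c) * w c)) ≤ ε := by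
  refine (ContinuousMap.dist_le hε).2 fun x => ?_
  have hw1 : ∑ c ∈ t, star (w c x) * w c x = 1 := by
    simpa using congrArg (fun k : C(X, ℂ) => k x) hw
  have hw2 : ∑ c ∈ t, ‖w c x‖ ^ 2 = 1 := by
    have : ∀ c, star (w c x) * w c x = ((‖w c x‖ ^ 2 : ℝ) : ℂ) := fun c => by
      simp [Complex.conj_mul']
    simp only [this] at hw1
    exact_mod_cast hw1
  have key : f x - (∑ c ∈ t, g c • (star (w c) * w c)) x
      = ∑ c ∈ t, (f x - g c) * (star (w c x) * w c x) := by
    simp only [sub_mul, Finset.sum_sub_distrib, ← Finset.mul_sum, hw1, mul_one]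
    simp [ContinuousMap.sum_apply]
  rw [dist_eq_norm, key]
  calc ‖∑ c ∈ t, (f x - g c) * (star (w c x) * w c x)‖
      ≤ ∑ c ∈ t, ε * ‖w c x‖ ^ 2 := norm_sum_le_of_le _ fun c _ => by
        rw [norm_mul, norm_mul, norm_star, ← sq]
        by_cases hc : w c x = 0
        · simp [hc]
        · gcongr
          simpa [dist_eq_norm] using h c x hc
    _ = ε := by rw [← Finset.mul_sum, hw2, mul_one]

section PositiveMap

variable {𝒜 : Type*} [CStarAlgebra 𝒜] [PartialOrder 𝒜] [StarOrderedRing 𝒜]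
  {H : Type*} [NormedAddCommGroup H] [InnerProductSpace ℂ H] [CompleteSpace H]

/-- Kadison's inequality for elements with finite spectral decomposition. -/
theorem PositiveLinearMap.norm_map_sum_apply_sq_le (Φ : 𝒜 →ₚ[ℂ] (H →L[ℂ] H)) (hΦ1 : Φ 1 = 1)
    {ι : Type*} {t : Finset ι} {b : ι → 𝒜} (hb : ∑ c ∈ t, star (b c) * b c = 1)
    (g : ι → ℂ) (x : H) :
    ‖Φ (∑ c ∈ t, g c • (star (b c) * b c)) x‖ ^ 2 ≤
      (inner ℂ x (Φ (∑ c ∈ t, (star (g c) * g c) • (star (b c) * b c)) x)).re := by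
  have hpos (c : ι) : ∃ d : H →L[ℂ] H, Φ (star (b c) * b c) = star d * d :=
    CStarAlgebra.nonneg_iff_eq_star_mul_self.1 (Φ.map_nonneg (star_mul_self_nonneg _))
  choose d hd using hpos
  have hinner (c : ι) (y z : H) : inner ℂ y ((star (d c) * d c) z) = inner ℂ (d c y) (d c z) := by
    rw [mul_apply_eq_comp, ContinuousLinearMap.star_eq_adjoint,
      ContinuousLinearMap.adjoint_inner_right]
  have hone (y : H) : ∑ c ∈ t, ‖d c y‖ ^ 2 = ‖y‖ ^ 2 := by
    have h := congrArg (fun T : H →L[ℂ] H => inner ℂ y (T y)) (congrArg Φ hb)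
    simp only [map_sum, hd, hΦ1, sum_apply, inner_sum, hinner,
      one_apply_eq_self, inner_self_eq_norm_sq_to_K] at h
    exact_mod_cast h
  have hrhs : (inner ℂ x (Φ (∑ c ∈ t, (star (g c) * g c) • (star (b c) * b c)) x)).re
      = ∑ c ∈ t, (‖g c‖ * ‖d c x‖) ^ 2 := by
    have h : inner ℂ x (Φ (∑ c ∈ t, (star (g c) * g c) • (star (b c) * b c)) x)
        = ((∑ c ∈ t, (‖g c‖ * ‖d c x‖) ^ 2 : ℝ) : ℂ) := by
      simp only [map_sum, map_smul, hd, sum_apply, inner_sum,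
        smul_apply, inner_smul_right, hinner, inner_self_eq_norm_sq_to_K,
        RCLike.star_def, Complex.conj_mul', mul_pow]
      push_cast
      rfl
    rw [h, Complex.ofReal_re]
  rw [hrhs]
  set y := Φ (∑ c ∈ t, g c • (star (b c) * b c)) x with hy
  have hyy : ‖y‖ ^ 2 ≤ ∑ c ∈ t, (‖g c‖ * ‖d c x‖) * ‖d c y‖ := by
    have h : inner ℂ y y = ∑ c ∈ t, g c * inner ℂ (d c y) (d c x) := by
      nth_rewrite 2 [hy]
      simp only [map_sum, map_smul, hd, sum_apply, inner_sum,
        smul_apply, inner_smul_right, hinner]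
    have h2 : ‖y‖ ^ 2 = ‖inner ℂ y y‖ := by simp [inner_self_eq_norm_sq_to_K]
    rw [h2, h]
    refine norm_sum_le_of_le _ fun c _ => ?_
    rw [norm_mul, mul_assoc, mul_comm ‖d c x‖]
    gcongr
    exact norm_inner_le_norm _ _
  have hcs := Finset.sum_mul_sq_le_sq_mul_sq t (fun c => ‖g c‖ * ‖d c x‖) (fun c => ‖d c y‖)
  rw [hone] at hcs
  rcases (sq_nonneg ‖y‖).eq_or_lt with h0 | h0
  · rw [← h0]; positivity
  · refine le_of_mul_le_mul_right ?_ h0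
    calc ‖y‖ ^ 2 * ‖y‖ ^ 2 = (‖y‖ ^ 2) ^ 2 := (sq _).symm
      _ ≤ (∑ c ∈ t, (‖g c‖ * ‖d c x‖) * ‖d c y‖) ^ 2 := by gcongr
      _ ≤ _ := hcs

/-- Kadison's inequality for normal elements. -/
theorem PositiveLinearMap.star_map_mul_map_le (Φ : 𝒜 →ₚ[ℂ] (H →L[ℂ] H)) (hΦ1 : Φ 1 = 1)
    (a : 𝒜) [ha : IsStarNormal a] : star (Φ a) * Φ a ≤ Φ (star a * a) := by
  let π : C(spectrum ℂ a, ℂ) →⋆ₐ[ℂ] 𝒜 := cfcHom (R := ℂ) ha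
  have hπ : Continuous π := cfcHom_continuous ha
  have hΦ : Continuous Φ := map_continuous Φ
  let f : C(spectrum ℂ a, ℂ) := (ContinuousMap.id ℂ).restrict (spectrum ℂ a)
  have hf : π f = a := cfcHom_id ha
  have key (x : H) : ‖Φ a x‖ ^ 2 ≤ (inner ℂ x (Φ (star a * a) x)).re := by
    let S : Set (C(spectrum ℂ a, ℂ) × C(spectrum ℂ a, ℂ)) :=
      {p | ‖Φ (π p.1) x‖ ^ 2 ≤ (inner ℂ x (Φ (π p.2) x)).re}
    have hS : IsClosed S := isClosed_le (by fun_prop) (by fun_prop)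
    have hmem : (f, star f * f) ∈ closure S := by
      refine Metric.mem_closure_iff.2 fun ε hε => ?_
      obtain ⟨t, w, hw, hfw⟩ :=
        exists_finset_sum_star_mul_self_eq_one (f.prodMk (star f * f)) (half_pos hε)
      refine ⟨(∑ c ∈ t, f c • (star (w c) * w c),
        ∑ c ∈ t, (star (f c) * f c) • (star (w c) * w c)), ?_, ?_⟩
      · have hb : ∑ c ∈ t, star (π (w c)) * π (w c) = 1 := by
          simpa only [map_sum, map_mul, map_star, map_one] using congrArg π hw
        have := Φ.norm_map_sum_apply_sq_le hΦ1 hb (fun c => f c) x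
        simpa only [S, Set.mem_ofPred_eq, map_sum π, map_smul π, map_mul π, map_star π] using this
      · have hd (c x) (hx : w c x ≠ 0) := max_le_iff.1 (hfw c x hx).le
        refine lt_of_le_of_lt (max_le ?_ ?_) (half_lt_self hε)
        · exact dist_sum_smul_star_mul_self_le hw f _ (half_pos hε).le fun c x hx => (hd c x hx).1
        · exact dist_sum_smul_star_mul_self_le hw (star f * f) _ (half_pos hε).le
            fun c x hx => (hd c x hx).2
    have := hS.closure_subset hmem
    simpa only [S, Set.mem_ofPred_eq, map_mul, map_star, hf] using this
  rw [← sub_nonneg, ContinuousLinearMap.nonneg_iff_isPositive,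
    ContinuousLinearMap.isPositive_def]
  refine ⟨?_, fun x => ?_⟩
  · exact ((IsSelfAdjoint.of_nonneg (Φ.map_nonneg (star_mul_self_nonneg a))).sub
      (IsSelfAdjoint.star_mul_self _)).isSymmetric
  · rw [ContinuousLinearMap.reApplyInnerSelf_apply, inner_re_symm,
      sub_apply, inner_sub_right, map_sub, sub_nonneg,
      mul_apply_eq_comp, ContinuousLinearMap.star_eq_adjoint,
      ContinuousLinearMap.adjoint_inner_right, inner_self_eq_norm_sq]
    exact key x

/-- The variance of a normal element under a unital positive map is at most its squared norm. -/
theorem PositiveLinearMap.norm_map_star_mul_self_sub_le (Φ : 𝒜 →ₚ[ℂ] (H →L[ℂ] H))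
    (hΦ1 : Φ 1 = 1) (a : 𝒜) [IsStarNormal a] :
    ‖Φ (star a * a) - star (Φ a) * Φ a‖ ≤ ‖a‖ ^ 2 := by
  calc ‖Φ (star a * a) - star (Φ a) * Φ a‖
      ≤ ‖Φ (star a * a)‖ := CStarAlgebra.norm_le_norm_of_nonneg_of_le
        (sub_nonneg.2 (Φ.star_map_mul_map_le hΦ1 a)) (sub_le_self _ (star_mul_self_nonneg _))
    _ ≤ ‖Φ 1‖ * ‖star a * a‖ := Φ.norm_apply_le_of_nonneg _ (star_mul_self_nonneg a)
    _ ≤ 1 * ‖star a * a‖ := by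
        gcongr
        rw [hΦ1]
        exact ContinuousLinearMap.norm_id_le
    _ = ‖a‖ ^ 2 := by rw [one_mul, CStarRing.norm_star_mul_self, sq]

/-- The variance under a unital positive map is invariant under scalar translations. -/
theorem PositiveLinearMap.map_star_mul_self_sub_translate (Φ : 𝒜 →ₚ[ℂ] (H →L[ℂ] H))
    (hΦ1 : Φ 1 = 1) (a : 𝒜) (z : ℂ) :
    Φ (star (a - z • 1) * (a - z • 1)) - star (Φ (a - z • 1)) * Φ (a - z • 1) =
      Φ (star a * a) - star (Φ a) * Φ a := by
  have hstar : Φ (star a) = star (Φ a) := map_star Φ a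
  simp only [star_sub, star_smul, star_one, sub_mul, mul_sub, smul_mul_assoc, mul_smul_comm,
    one_mul, mul_one, map_sub, map_smul, hΦ1, hstar]
  abel

end PositiveMap


/-- A unital positive linear map `Φ` from a unital `C*`-algebra into `B(H)` satisfies
`‖Φ(A*A) − Φ(A)*Φ(A)‖ ≤ Δ(A,‖·‖)²` for every normal element `A`, where
`Δ(C,‖·‖) = inf_{λ ∈ ℂ} ‖C − λ·1‖`.  Positivity of an element `x` of a `C*`-algebra is
expressed by `∃ c, x = star c * c`. -/
theorem variance_le_of_normal
    {𝒜 : Type*} [NormedRing 𝒜] [StarRing 𝒜] [CStarRing 𝒜] [NormedAlgebra ℂ 𝒜]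
    [StarModule ℂ 𝒜] [CompleteSpace 𝒜]
    {H : Type*} [NormedAddCommGroup H] [InnerProductSpace ℂ H] [CompleteSpace H]
    (Φ : 𝒜 →ₗ[ℂ] (H →L[ℂ] H)) (hΦ1 : Φ 1 = 1)
    (hΦpos : ∀ a : 𝒜, (∃ c : 𝒜, a = star c * c) → ∃ d : H →L[ℂ] H, Φ a = star d * d)
    (A : 𝒜) (hA : star A * A = A * star A) :
    ‖Φ (star A * A) - star (Φ A) * Φ A‖ ≤ (⨅ z : ℂ, ‖A - z • (1 : 𝒜)‖) ^ 2 := by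
  let : CStarAlgebra 𝒜 := {}
  let : PartialOrder 𝒜 := CStarAlgebra.spectralOrder 𝒜
  have : StarOrderedRing 𝒜 := CStarAlgebra.spectralOrderedRing 𝒜
  let Ψ : 𝒜 →ₚ[ℂ] (H →L[ℂ] H) := PositiveLinearMap.mk₀ Φ fun x hx =>
    CStarAlgebra.nonneg_iff_eq_star_mul_self.2
      (hΦpos x (CStarAlgebra.nonneg_iff_eq_star_mul_self.1 hx))
  have hz (z : ℂ) : ‖Φ (star A * A) - star (Φ A) * Φ A‖ ≤ ‖A - z • (1 : 𝒜)‖ ^ 2 := by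
    have : IsStarNormal (A - z • (1 : 𝒜)) := ⟨by
      simp only [commute_iff_eq, star_sub, star_smul, star_one, sub_mul, mul_sub, hA,
        smul_mul_assoc, mul_smul_comm, one_mul, mul_one, smul_sub, smul_comm z (star z)]
      abel⟩
    have h := Ψ.norm_map_star_mul_self_sub_le hΦ1 (A - z • (1 : 𝒜))
    rwa [Ψ.map_star_mul_self_sub_translate hΦ1] at h
  have hsqrt : √‖Φ (star A * A) - star (Φ A) * Φ A‖ ≤ ⨅ z : ℂ, ‖A - z • (1 : 𝒜)‖ :=
    le_ciInf fun z => Real.sqrt_le_iff.2 ⟨norm_nonneg _, hz z⟩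
  exact (Real.sqrt_le_iff.1 hsqrt).2
end

section
/- Let 𝒜 be a unital C*-algebra, H a complex Hilbert space, and Φ : 𝒜 → B(H) a unital completely positive linear map. Then for every element A ∈ 𝒜, ‖Φ(A*A) − Φ(A)*Φ(A)‖ ≤ Δ(A,‖·‖)². -/
open scoped Matrix

namespace IsNPositiveMap

section StarRing

variable {𝒜 ℬ : Type*} [Ring 𝒜] [StarRing 𝒜] [Ring ℬ] [StarRing ℬ]

theorem map_star_mul_self_nonneg [PartialOrder ℬ] [StarOrderedRing ℬ] {Φ : 𝒜 → ℬ}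
    (hΦ : IsNPositiveMap Φ 1) (a : 𝒜) : 0 ≤ Φ (star a * a) := by
  obtain ⟨D, hD⟩ := hΦ _ ⟨!![a], rfl⟩
  have h : Φ (star a * a) = star (D 0 0) * D 0 0 := by
    simpa [Matrix.mul_apply] using congr_fun₂ hD 0 0
  rw [h]
  exact star_mul_self_nonneg _

/-- The Gram decomposition of the image of the positive matrix `!![1, a; star a, star a * a]`. -/
theorem exists_gram_s5 {Φ : 𝒜 → ℬ} (hΦ : IsNPositiveMap Φ 2) (a : 𝒜) :
    ∃ p q r s : ℬ, Φ 1 = star p * p + star r * r ∧ Φ a = star p * q + star r * s ∧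
      Φ (star a) = star q * p + star s * r ∧ Φ (star a * a) = star q * q + star s * s := by
  obtain ⟨D, hD⟩ := hΦ _ ⟨!![1, a; 0, 0], rfl⟩
  refine ⟨D 0 0, D 0 1, D 1 0, D 1 1, ?_, ?_, ?_, ?_⟩
  · simpa [Matrix.mul_apply, Fin.sum_univ_two] using congr_fun₂ hD 0 0
  · simpa [Matrix.mul_apply, Fin.sum_univ_two] using congr_fun₂ hD 0 1
  · simpa [Matrix.mul_apply, Fin.sum_univ_two] using congr_fun₂ hD 1 0
  · simpa [Matrix.mul_apply, Fin.sum_univ_two] using congr_fun₂ hD 1 1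

theorem map_star {Φ : 𝒜 → ℬ} (hΦ : IsNPositiveMap Φ 2) (a : 𝒜) :
    Φ (star a) = star (Φ a) := by
  obtain ⟨p, q, r, s, -, ha, hs, -⟩ := hΦ.exists_gram_s5 a
  simp [ha, hs]

/-- The Kadison–Schwarz inequality for unital `2`-positive maps. -/
theorem star_map_mul_map_le [PartialOrder ℬ] [StarOrderedRing ℬ] {Φ : 𝒜 → ℬ}
    (hΦ : IsNPositiveMap Φ 2) (hΦ1 : Φ 1 = 1) (a : 𝒜) :
    star (Φ a) * Φ a ≤ Φ (star a * a) := by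
  obtain ⟨p, q, r, s, h1, ha, hs, hsa⟩ := hΦ.exists_gram_s5 a
  rw [← sub_nonneg]
  have key : Φ (star a * a) - star (Φ a) * Φ a =
      star (q - p * Φ a) * (q - p * Φ a) + star (s - r * Φ a) * (s - r * Φ a) := by
    have e : star (q - p * Φ a) * (q - p * Φ a) + star (s - r * Φ a) * (s - r * Φ a) =
        (star q * q + star s * s) - (star q * p + star s * r) * Φ a
          - star (Φ a) * (star p * q + star r * s)
          + star (Φ a) * (star p * p + star r * r) * Φ a := by
      simp only [star_sub, star_mul]
      noncomm_ring
    rw [e, ← h1, ← ha, ← hs, ← hsa, hΦ1, hΦ.map_star]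
    noncomm_ring
  rw [key]
  exact add_nonneg (star_mul_self_nonneg _) (star_mul_self_nonneg _)

end StarRing

theorem map_star_mul_self_le {𝒜 ℬ : Type*} [CStarAlgebra 𝒜] [CStarAlgebra ℬ] [PartialOrder ℬ]
    [StarOrderedRing ℬ] {Φ : 𝒜 →ₗ[ℂ] ℬ} (hΦ : IsNPositiveMap Φ 1) (hΦ1 : Φ 1 = 1) (a : 𝒜) :
    Φ (star a * a) ≤ algebraMap ℝ ℬ (‖a‖ ^ 2) := by
  let := CStarAlgebra.spectralOrder 𝒜
  let := CStarAlgebra.spectralOrderedRing 𝒜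
  have h : 0 ≤ algebraMap ℝ 𝒜 (‖a‖ ^ 2) - star a * a :=
    sub_nonneg.mpr CStarAlgebra.star_mul_le_algebraMap_norm_sq
  obtain ⟨c, hc⟩ := CStarAlgebra.nonneg_iff_eq_star_mul_self.mp h
  have hpos := hΦ.map_star_mul_self_nonneg c
  rw [← hc, map_sub, sub_nonneg] at hpos
  refine hpos.trans_eq ?_
  rw [Algebra.algebraMap_eq_smul_one, Algebra.algebraMap_eq_smul_one,
    LinearMap.map_smul_of_tower, hΦ1]

theorem norm_map_star_mul_self_sub_le {𝒜 ℬ : Type*} [CStarAlgebra 𝒜] [CStarAlgebra ℬ]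
    [PartialOrder ℬ] [StarOrderedRing ℬ] {Φ : 𝒜 →ₗ[ℂ] ℬ} (hΦ : IsNPositiveMap Φ 1)
    (hΦ₂ : IsNPositiveMap Φ 2) (hΦ1 : Φ 1 = 1) (a : 𝒜) :
    ‖Φ (star a * a) - star (Φ a) * Φ a‖ ≤ ‖a‖ ^ 2 := by
  refine (CStarAlgebra.norm_le_iff_le_algebraMap _ (sq_nonneg _)
    (sub_nonneg.mpr (hΦ₂.star_map_mul_map_le hΦ1 a))).mpr ?_
  exact (sub_le_self _ (star_mul_self_nonneg _)).trans (hΦ.map_star_mul_self_le hΦ1 a)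

/-- The variance of `a` under a unital `2`-positive map is invariant under scalar translations. -/
theorem map_star_mul_self_sub_smul_one {𝒜 ℬ : Type*} [Ring 𝒜] [StarRing 𝒜] [Algebra ℂ 𝒜]
    [StarModule ℂ 𝒜] [Ring ℬ] [StarRing ℬ] [Algebra ℂ ℬ] [StarModule ℂ ℬ] {Φ : 𝒜 →ₗ[ℂ] ℬ}
    (hΦ : IsNPositiveMap Φ 2) (hΦ1 : Φ 1 = 1) (a : 𝒜) (z : ℂ) :
    Φ (star (a - z • 1) * (a - z • 1)) - star (Φ (a - z • 1)) * Φ (a - z • 1) =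
      Φ (star a * a) - star (Φ a) * Φ a := by
  simp only [star_sub, star_smul, star_one, sub_mul, mul_sub, smul_mul_assoc, mul_smul_comm,
    one_mul, mul_one, map_sub, map_smul, hΦ1, hΦ.map_star]
  abel

end IsNPositiveMap

/-- A unital completely positive linear map `Φ` from a unital `C*`-algebra into `B(H)`
satisfies `‖Φ(A*A) − Φ(A)*Φ(A)‖ ≤ Δ(A,‖·‖)²` for every element `A`, where
`Δ(C,‖·‖) = inf_{λ ∈ ℂ} ‖C − λ·1‖`. -/
theorem variance_le_of_completelyPositive
    {𝒜 : Type*} [NormedRing 𝒜] [StarRing 𝒜] [CStarRing 𝒜] [NormedAlgebra ℂ 𝒜]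
    [StarModule ℂ 𝒜] [CompleteSpace 𝒜]
    {H : Type*} [NormedAddCommGroup H] [InnerProductSpace ℂ H] [CompleteSpace H]
    (Φ : 𝒜 →ₗ[ℂ] (H →L[ℂ] H)) (hΦ1 : Φ 1 = 1)
    (hΦ : ∀ n : ℕ, IsNPositiveMap (⇑Φ) n)
    (A : 𝒜) :
    ‖Φ (star A * A) - star (Φ A) * Φ A‖ ≤ (⨅ z : ℂ, ‖A - z • (1 : 𝒜)‖) ^ 2 := by
  let : CStarAlgebra 𝒜 := {}
  have h (z : ℂ) : √‖Φ (star A * A) - star (Φ A) * Φ A‖ ≤ ‖A - z • (1 : 𝒜)‖ := by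
    rw [← (hΦ 2).map_star_mul_self_sub_smul_one hΦ1 A z]
    exact Real.sqrt_le_iff.mpr
      ⟨norm_nonneg _, (hΦ 1).norm_map_star_mul_self_sub_le (hΦ 2) hΦ1 _⟩
  exact (Real.sqrt_le_left (Real.iInf_nonneg fun _ => norm_nonneg _)).mp (le_ciInf h)
end

section
/- Let 𝒜 be a unital C*-algebra, let m be an integer greater than 2, and let A ∈ 𝒜 satisfy ‖A‖ < 1 − 2/m. Then there exist m unitary elements U₁, …, U_m ∈ 𝒜 such that m·A = U₁ + ⋯ + U_m. -/
section UnitaryMeans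

variable {A : Type*} [CStarAlgebra A]

/-- An invertible element of a C⋆-algebra factors as a unitary times its absolute value. -/
lemma IsUnit.exists_unitary_mul_cfcAbs [PartialOrder A] [StarOrderedRing A] {a : A}
    (ha : IsUnit a) : ∃ w ∈ unitary A, a = w * CFC.abs a := by
  have habs : IsUnit (CFC.abs a) := by
    rw [← isUnit_pow_iff two_ne_zero, CFC.abs_sq]
    exact ha.star.mul ha
  obtain ⟨b, hb⟩ := habs
  have hbs : star (↑b⁻¹ : A) = ↑b⁻¹ := by
    have : star b = b := Units.ext (by
      rw [Units.coe_star, hb, (CFC.abs_nonneg a).isSelfAdjoint.star_eq])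
    rw [← Units.coe_star, star_inv, this]
  have hsq : star a * a = b * b := by rw [hb, CFC.abs_mul_abs]
  have hw : star (a * ↑b⁻¹) * (a * ↑b⁻¹) = 1 := by
    rw [star_mul, hbs, mul_assoc, ← mul_assoc (star a), hsq]
    simp
  refine ⟨a * ↑b⁻¹, Unitary.mem_iff.2 ⟨hw, ?_⟩, by simp [← hb]⟩
  exact (ha.mul b⁻¹.isUnit).mul_right_cancel (by rw [mul_assoc, hw, mul_one, one_mul])

/-- An invertible element of norm at most one is the mean of two unitaries. -/
lemma IsUnit.exists_unitary_add_unitary_eq_two_smul {a : A} (ha : IsUnit a) (hn : ‖a‖ ≤ 1) :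
    ∃ u ∈ unitary A, ∃ v ∈ unitary A, (2 : ℝ) • a = u + v := by
  let _ := CStarAlgebra.spectralOrder A
  let _ := CStarAlgebra.spectralOrderedRing A
  obtain ⟨w, hw, haw⟩ := ha.exists_unitary_mul_cfcAbs
  have habs : IsSelfAdjoint (CFC.abs a) := (CFC.abs_nonneg a).isSelfAdjoint
  have hsqrt : IsSelfAdjoint (CFC.sqrt (1 - CFC.abs a ^ 2)) := (CFC.sqrt_nonneg _).isSelfAdjoint
  have hx := habs.self_add_I_smul_cfcSqrt_sub_sq_mem_unitary _
    ((CFC.norm_abs (a := a)).trans_le hn)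
  refine ⟨w * _, mul_mem hw hx, w * star _, mul_mem hw (Unitary.star_mem hx), ?_⟩
  rw [← mul_add, star_add, star_smul, habs.star_eq, hsqrt.star_eq, ← starRingEnd_apply,
    Complex.conj_I, neg_smul, ← sub_eq_add_neg, add_add_sub_cancel, ← two_smul ℝ, mul_smul_comm,
    ← haw]

/-- The sum of a unitary and an element of the open unit ball is a sum of two unitaries. -/
lemma exists_unitary_add_unitary_eq_unitary_add {v s : A} (hv : v ∈ unitary A) (hs : ‖s‖ < 1) :
    ∃ u₁ ∈ unitary A, ∃ u₂ ∈ unitary A, v + s = u₁ + u₂ := by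
  nontriviality A
  have hvs : ‖star v * s‖ < 1 := by
    rwa [CStarRing.norm_mem_unitary_mul s (Unitary.star_mem hv)]
  have hu : IsUnit (1 + star v * s) := by
    simpa using isUnit_one_sub_of_norm_lt_one (x := -(star v * s)) (by rwa [norm_neg])
  have hn : ‖(2⁻¹ : ℝ) • (1 + star v * s)‖ ≤ 1 := by
    have := norm_add_le (1 : A) (star v * s)
    rw [norm_one] at this
    rw [norm_smul, norm_inv, Real.norm_two]
    linarith
  obtain ⟨u₁, h₁, u₂, h₂, h⟩ :=
    (hu.smul (Units.mk0 (2⁻¹ : ℝ) (by norm_num))).exists_unitary_add_unitary_eq_two_smul hn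
  refine ⟨v * u₁, mul_mem hv h₁, v * u₂, mul_mem hv h₂, ?_⟩
  rw [← mul_add, ← h, Units.smul_mk0, smul_inv_smul₀ two_ne_zero, mul_add, mul_one, ← mul_assoc,
    Unitary.mul_star_self_of_mem hv, one_mul]

lemma exists_sum_unitary_eq_unitary_add_nsmul {s : A} (hs : ‖s‖ < 1) (n : ℕ) {v : A}
    (hv : v ∈ unitary A) :
    ∃ U : Fin (n + 1) → A, (∀ i, U i ∈ unitary A) ∧ v + n • s = ∑ i, U i := by
  induction n generalizing v with
  | zero => exact ⟨fun _ ↦ v, fun _ ↦ hv, by simp⟩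
  | succ n ih =>
    obtain ⟨u₁, h₁, u₂, h₂, h⟩ := exists_unitary_add_unitary_eq_unitary_add hv hs
    obtain ⟨U, hU, hsum⟩ := ih h₁
    refine ⟨Fin.cons u₂ U, Fin.cases h₂ hU, ?_⟩
    rw [Fin.sum_cons, ← hsum, succ_nsmul', ← add_assoc, h]
    abel

end UnitaryMeans

/-- If `A` is an element of a unital `C*`-algebra with `‖A‖ < 1 − 2/m` for some integer
`m > 2`, then `m·A` is a sum of `m` unitary elements. -/
theorem exists_sum_unitaries
    {𝒜 : Type*} [NormedRing 𝒜] [StarRing 𝒜] [CStarRing 𝒜] [NormedAlgebra ℂ 𝒜]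
    [StarModule ℂ 𝒜] [CompleteSpace 𝒜]
    (m : ℕ) (hm : 2 < m) (A : 𝒜) (hA : ‖A‖ < 1 - 2 / (m : ℝ)) :
    ∃ U : Fin m → 𝒜, (∀ i, U i ∈ unitary 𝒜) ∧ m • A = ∑ i, U i := by
  let _ : CStarAlgebra 𝒜 := {}
  obtain ⟨n, rfl⟩ : ∃ n, m = n + 1 := ⟨m - 1, by omega⟩
  have hn : (0 : ℝ) < n := by exact_mod_cast (by omega : 0 < n)
  have hs : ‖(n : ℝ)⁻¹ • ((n + 1) • A - 1)‖ < 1 := by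
    nontriviality 𝒜
    have h₁ : ‖(n + 1) • A‖ ≤ ((n + 1 : ℕ) : ℝ) * ‖A‖ := norm_nsmul_le
    have h₂ := norm_sub_le ((n + 1) • A) 1
    have h₃ : ((n + 1 : ℕ) : ℝ) * ‖A‖ < n - 1 := by
      calc ((n + 1 : ℕ) : ℝ) * ‖A‖ < ((n + 1 : ℕ) : ℝ) * (1 - 2 / ((n + 1 : ℕ) : ℝ)) := by gcongr
        _ = n - 1 := by
          push_cast
          field_simp
          ring
    rw [norm_one] at h₂
    rw [norm_smul, norm_inv, Real.norm_natCast, inv_mul_lt_one₀ hn]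
    linarith
  obtain ⟨U, hU, hsum⟩ := exists_sum_unitary_eq_unitary_add_nsmul hs n (one_mem (unitary 𝒜))
  refine ⟨U, hU, ?_⟩
  rw [← hsum, ← Nat.cast_smul_eq_nsmul ℝ n, smul_inv_smul₀ hn.ne', add_sub_cancel]
end

section
/- Let 𝒜 be a unital C*-algebra, H a complex Hilbert space, and Φ : 𝒜 → B(H) a unital n-positive linear map for some integer n ≥ 3. Then for all A, B ∈ 𝒜, ‖Φ(AB) − Φ(A)Φ(B)‖ ≤ ‖A‖ · ‖B‖. -/
open scoped Matrix

open scoped InnerProductSpace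

/-- A Gram-type representation of an `n`-positive map into `B(H)`: for any `n`-tuple `v`, the
sesquilinear forms of `Φ (star (v i) * v j)` are the mixed inner products of vectors in `Hⁿ`. -/
theorem IsNPositiveMap.exists_inner_eq {𝒜 H : Type*} [Ring 𝒜] [StarRing 𝒜]
    [NormedAddCommGroup H] [InnerProductSpace ℂ H] [CompleteSpace H]
    {Φ : 𝒜 → (H →L[ℂ] H)} {n : ℕ} (hn : 0 < n) (hΦ : IsNPositiveMap Φ n) (v : Fin n → 𝒜) :
    ∃ e : Fin n → H → PiLp 2 (fun _ : Fin n => H), ∀ i j x y,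
      ⟪e i x, e j y⟫_ℂ = ⟪x, Φ (star (v i) * v j) y⟫_ℂ := by
  obtain ⟨D, hD⟩ := hΦ _ ⟨Matrix.of fun k j => if k = ⟨0, hn⟩ then v j else 0, rfl⟩
  refine ⟨fun i x => WithLp.toLp 2 fun k => D k i x, fun i j x y => ?_⟩
  have h := congrFun (congrFun hD i) j
  simp only [Matrix.map_apply, Matrix.mul_apply, Matrix.conjTranspose_apply, Matrix.of_apply,
    mul_ite, mul_zero, Finset.sum_ite_eq', Finset.mem_univ, if_true] at h
  rw [h, PiLp.inner_apply, sum_apply, inner_sum]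
  refine Finset.sum_congr rfl fun k _ => ?_
  rw [mul_apply_eq_comp, ContinuousLinearMap.star_eq_adjoint,
    ContinuousLinearMap.adjoint_inner_right]

/-- In a unital C⋆-algebra, `‖b‖² - b⋆b` is of the form `c⋆c`. -/
theorem CStarRing.exists_star_mul_self_add {𝒜 : Type*} [NormedRing 𝒜] [StarRing 𝒜] [CStarRing 𝒜]
    [NormedAlgebra ℂ 𝒜] [StarModule ℂ 𝒜] [CompleteSpace 𝒜] (b : 𝒜) :
    ∃ c : 𝒜, star c * c + star b * b = ((‖b‖ ^ 2 : ℝ) : ℂ) • (1 : 𝒜) := by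
  let : CStarAlgebra 𝒜 := {}
  let : PartialOrder 𝒜 := CStarAlgebra.spectralOrder 𝒜
  let : StarOrderedRing 𝒜 := CStarAlgebra.spectralOrderedRing 𝒜
  have h : star b * b ≤ algebraMap ℝ 𝒜 (‖b‖ ^ 2) := CStarAlgebra.star_mul_le_algebraMap_norm_sq
  obtain ⟨c, hc⟩ := CStarAlgebra.nonneg_iff_eq_star_mul_self.mp (sub_nonneg.mpr h)
  refine ⟨c, ?_⟩
  rw [← hc, sub_add_cancel, Algebra.algebraMap_eq_smul_one]
  exact (Complex.coe_smul _ _).symm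

/-- A unital `n`-positive map `Φ` with `n ≥ 1` satisfies `Φ (b⋆b) ≤ ‖b‖²` as quadratic forms. -/
theorem IsNPositiveMap.re_inner_star_mul_self_le
    {𝒜 : Type*} [NormedRing 𝒜] [StarRing 𝒜] [CStarRing 𝒜] [NormedAlgebra ℂ 𝒜]
    [StarModule ℂ 𝒜] [CompleteSpace 𝒜]
    {H : Type*} [NormedAddCommGroup H] [InnerProductSpace ℂ H] [CompleteSpace H]
    {Φ : 𝒜 →ₗ[ℂ] (H →L[ℂ] H)} (hΦ1 : Φ 1 = 1) {n : ℕ} (hn : 0 < n)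
    (hΦ : IsNPositiveMap (⇑Φ) n) (b : 𝒜) (x : H) :
    (⟪x, Φ (star b * b) x⟫_ℂ).re ≤ (‖b‖ * ‖x‖) ^ 2 := by
  obtain ⟨c, hc⟩ := CStarRing.exists_star_mul_self_add b
  obtain ⟨e, he⟩ := hΦ.exists_inner_eq hn fun _ => c
  have h1 := he ⟨0, hn⟩ ⟨0, hn⟩ x x
  have h2 : 0 ≤ (⟪x, Φ (star c * c) x⟫_ℂ).re := by
    rw [← h1]
    exact inner_self_nonneg (𝕜 := ℂ)
  have h3 := congrArg (fun a => (⟪x, Φ a x⟫_ℂ).re) hc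
  have h4 : (⟪x, x⟫_ℂ).re = ‖x‖ ^ 2 := inner_self_eq_norm_sq (𝕜 := ℂ) x
  simp only [map_add, map_smul, hΦ1, add_apply, inner_add_right,
    smul_apply, one_apply_eq_self, inner_smul_right,
    Complex.add_re, Complex.re_ofReal_mul, h4] at h3
  rw [mul_pow]
  linarith

/-- A unital `n`-positive linear map `Φ` (`n ≥ 3`) from a unital `C*`-algebra into `B(H)`
satisfies `‖Φ(AB) − Φ(A)Φ(B)‖ ≤ ‖A‖ ‖B‖` for all `A, B`. -/
theorem norm_mul_bound_nPositive
    {𝒜 : Type*} [NormedRing 𝒜] [StarRing 𝒜] [CStarRing 𝒜] [NormedAlgebra ℂ 𝒜]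
    [StarModule ℂ 𝒜] [CompleteSpace 𝒜]
    {H : Type*} [NormedAddCommGroup H] [InnerProductSpace ℂ H] [CompleteSpace H]
    (Φ : 𝒜 →ₗ[ℂ] (H →L[ℂ] H)) (hΦ1 : Φ 1 = 1)
    (n : ℕ) (hn : 3 ≤ n) (hΦ : IsNPositiveMap (⇑Φ) n)
    (A B : 𝒜) :
    ‖Φ (A * B) - Φ A * Φ B‖ ≤ ‖A‖ * ‖B‖ := by
  have h0 : 0 < n := by omega
  obtain ⟨e, he⟩ := hΦ.exists_inner_eq h0
    fun k => if k.val = 0 then star A else if k.val = 1 then B else 1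
  have h01 := he ⟨0, h0⟩ ⟨1, by omega⟩
  have h02 := he ⟨0, h0⟩ ⟨2, by omega⟩
  have h21 := he ⟨2, by omega⟩ ⟨1, by omega⟩
  have h00 := he ⟨0, h0⟩ ⟨0, h0⟩
  have h11 := he ⟨1, by omega⟩ ⟨1, by omega⟩
  have h22 := he ⟨2, by omega⟩ ⟨2, by omega⟩
  generalize e ⟨0, h0⟩ = a at *
  generalize e ⟨1, by omega⟩ = b at *
  generalize e ⟨2, by omega⟩ = u at *
  simp only [if_true, OfNat.ofNat_ne_zero, one_ne_zero, OfNat.ofNat_ne_one, if_false, star_one,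
    one_mul, mul_one, star_star, hΦ1, one_apply_eq_self] at h01 h02 h21 h00 h11 h22
  have ha (x : H) : ‖a x‖ ≤ ‖A‖ * ‖x‖ := by
    have h := hΦ.re_inner_star_mul_self_le hΦ1 h0 (star A) x
    rw [star_star, ← h00, norm_star] at h
    exact le_of_sq_le_sq ((inner_self_eq_norm_sq (𝕜 := ℂ) (a x)).symm.trans_le h) (by positivity)
  have hb (y : H) : ‖b y - u (Φ B y)‖ ≤ ‖B‖ * ‖y‖ := by
    have h := hΦ.re_inner_star_mul_self_le hΦ1 h0 B y
    rw [← h11] at h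
    have hbb : (⟪b y, b y⟫_ℂ).re = ‖b y‖ ^ 2 := inner_self_eq_norm_sq (𝕜 := ℂ) (b y)
    have huu : (⟪u (Φ B y), u (Φ B y)⟫_ℂ).re = ‖u (Φ B y)‖ ^ 2 :=
      inner_self_eq_norm_sq (𝕜 := ℂ) _
    have hub : (⟪u (Φ B y), b y⟫_ℂ).re = ‖u (Φ B y)‖ ^ 2 := by rw [← huu, h21, h22]
    have hsub := norm_sub_sq (𝕜 := ℂ) (b y) (u (Φ B y))
    rw [inner_re_symm] at hsub
    change _ = _ - 2 * (⟪u (Φ B y), b y⟫_ℂ).re + _ at hsub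
    refine le_of_sq_le_sq ?_ (by positivity)
    linarith [sq_nonneg ‖u (Φ B y)‖]
  refine ContinuousLinearMap.opNorm_le_bound _ (by positivity) fun y => ?_
  set z := (Φ (A * B) - Φ A * Φ B) y with hz
  have hzz : ⟪z, z⟫_ℂ = ⟪a z, b y - u (Φ B y)⟫_ℂ := by
    rw [inner_sub_right, h01, h02, ← inner_sub_right]
    rfl
  have h : ‖z‖ * ‖z‖ ≤ ‖z‖ * (‖A‖ * ‖B‖ * ‖y‖) := by
    calc ‖z‖ * ‖z‖ = ‖⟪z, z⟫_ℂ‖ := by rw [← sq, inner_self_eq_norm_sq_to_K]; simp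
      _ ≤ ‖a z‖ * ‖b y - u (Φ B y)‖ := hzz ▸ norm_inner_le_norm _ _
      _ ≤ (‖A‖ * ‖z‖) * (‖B‖ * ‖y‖) := by gcongr; exacts [ha z, hb y]
      _ = ‖z‖ * (‖A‖ * ‖B‖ * ‖y‖) := by ring
  rcases (norm_nonneg z).eq_or_lt with h' | h'
  · rw [← h']
    positivity
  · exact le_of_mul_le_mul_left h h'
end
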